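/- arXiv:1205.6228 — 2 statements merged into one kernel-verified Lean document; each statement's English description precedes it below -/
import Mathlib

section
/- Let A be a finite set with at least 3 elements and let O be a subset of A with 2 ≤ |O| < |A|. Let 0 < p_A < 1 and 0 < p_B ≤ 1 be real numbers. In a probability space, let (E_{uv}) be a family of mutually independent events indexed by the unordered pairs {u,v} of distinct elements of A, where P(E_{uv}) = 1 − (1−p_A)(1−p_B) if both u,v ∈ O, and P(E_{uv}) = p_A otherwise. For u ∈ A define the (random) internal degree d(u) as the number of v ∈ A, v ≠ u, such that E_{uv} occurs. Then the probability that some node of O attains the maximal internal degree, P(∃ o ∈ O, d(o) = max_{u∈A} d(u)), is strictly greater than |O|/|A|. -/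
open MeasureTheory ProbabilityTheory

section JointLaw

variable {ι Ω Ω' : Type*} [MeasurableSpace Ω] [MeasurableSpace Ω']

/-- The indicator functions of two events of the same probability have the same law. -/
lemma map_indicator_eq_of_measure_eq {μ : Measure Ω} {ν : Measure Ω'}
    [IsProbabilityMeasure μ] [IsProbabilityMeasure ν] {E : Set Ω} {F : Set Ω'}
    (hE : MeasurableSet E) (hF : MeasurableSet F) (h : μ E = ν F) :
    μ.map (E.indicator fun _ => (1 : ℕ)) = ν.map (F.indicator fun _ => (1 : ℕ)) := by
  classical
  ext t ht
  rw [Measure.map_apply (measurable_const.indicator hE) ht,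
    Measure.map_apply (measurable_const.indicator hF) ht,
    Set.indicator_const_preimage_eq_union, Set.indicator_const_preimage_eq_union]
  split_ifs <;> simp [h, prob_compl_eq_one_sub, hE, hF]

/-- The joint law of finitely many independent events is determined by their probabilities. -/
lemma iIndepSet_measure_setOf_eq [Finite ι] {μ : Measure Ω} {ν : Measure Ω'}
    [IsProbabilityMeasure μ] [IsProbabilityMeasure ν] {E : ι → Set Ω} {F : ι → Set Ω'}
    (hE : ∀ i, MeasurableSet (E i)) (hF : ∀ i, MeasurableSet (F i))
    (hEi : iIndepSet E μ) (hFi : iIndepSet F ν) (h : ∀ i, μ (E i) = ν (F i))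
    (P : (ι → Prop) → Prop) :
    μ {ω | P fun i => ω ∈ E i} = ν {ω | P fun i => ω ∈ F i} := by
  have := Fintype.ofFinite ι
  have hEm : ∀ i, Measurable ((E i).indicator fun _ => (1 : ℕ)) :=
    fun i => measurable_const.indicator (hE i)
  have hFm : ∀ i, Measurable ((F i).indicator fun _ => (1 : ℕ)) :=
    fun i => measurable_const.indicator (hF i)
  have key := (iIndepFun_iff_map_fun_eq_pi_map fun i => (hEm i).aemeasurable).1
    (hEi.iIndepFun_indicator (β := ℕ))
  have key' := (iIndepFun_iff_map_fun_eq_pi_map fun i => (hFm i).aemeasurable).1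
    (hFi.iIndepFun_indicator (β := ℕ))
  simp_rw [fun i => map_indicator_eq_of_measure_eq (hE i) (hF i) (h i)] at key
  have hlaw := congrArg (fun m => m {x : ι → ℕ | P fun i => x i = 1}) (key.trans key'.symm)
  rw [Measure.map_apply (measurable_pi_iff.2 hEm) .of_discrete,
    Measure.map_apply (measurable_pi_iff.2 hFm) .of_discrete] at hlaw
  simpa [Set.preimage, Set.indicator_apply] using hlaw

/-- Threshold events on distinct coordinates of the cube are independent. -/
lemma iIndepSet_coord_le {κ : Type*} [Fintype κ] (q : κ → unitInterval) :
    iIndepSet (fun s => {U : κ → unitInterval | U s ≤ q s}) volume := by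
  have hm : ∀ s, MeasurableSet {U : κ → unitInterval | U s ≤ q s} :=
    fun s => measurableSet_le (measurable_pi_apply s) measurable_const
  rw [iIndepSet_iff_meas_biInter hm]
  intro S
  have hi : iIndepFun (fun s (U : κ → unitInterval) => U s) volume :=
    iIndepFun_pi (μ := fun _ : κ => (volume : Measure unitInterval))
      (X := fun _ => id) fun _ => aemeasurable_id
  exact hi.measure_inter_preimage_eq_mul S (sets := fun s => Set.Iic (q s))
    fun _ _ => measurableSet_Iic

lemma volume_coord_le {κ : Type*} [Fintype κ] (s : κ) (q : unitInterval) :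
    volume {U : κ → unitInterval | U s ≤ q} = ENNReal.ofReal q := by
  rw [← unitInterval.volume_Iic]
  exact (measurePreserving_eval (fun _ : κ => (volume : Measure unitInterval)) s).measure_preimage
    measurableSet_Iic.nullMeasurableSet

end JointLaw

section Degree

variable {V : Type*}

/-- The degree of `u` inside `A` in the graph whose edge relation is `g`. -/
noncomputable def internalDegree (A : Finset V) (g : Sym2 V → Prop) (u : V) : ℕ :=
  {v : V | v ∈ A ∧ v ≠ u ∧ g s(u, v)}.ncard

open Classical in
/-- The nodes of `A` of maximal internal degree. -/
noncomputable def connectors (A : Finset V) (g : Sym2 V → Prop) : Finset V :=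
  {u ∈ A | ∀ v ∈ A, internalDegree A g v ≤ internalDegree A g u}

open Classical in
/-- The probability that `u` is chosen when a connector is chosen uniformly. -/
noncomputable def connectorWeight (A : Finset V) (g : Sym2 V → Prop) (u : V) : ℝ :=
  if u ∈ connectors A g then ((connectors A g).card : ℝ)⁻¹ else 0

lemma mem_connectors {A : Finset V} {g : Sym2 V → Prop} {u : V} :
    u ∈ connectors A g ↔
      u ∈ A ∧ ∀ v ∈ A, internalDegree A g v ≤ internalDegree A g u := by
  simp [connectors]

lemma connectors_subset (A : Finset V) (g : Sym2 V → Prop) : connectors A g ⊆ A :=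
  fun _ hu => (mem_connectors.1 hu).1

lemma connectors_nonempty {A : Finset V} (hA : A.Nonempty) (g : Sym2 V → Prop) :
    (connectors A g).Nonempty := by
  obtain ⟨u, hu, h⟩ := A.exists_max_image (internalDegree A g) hA
  exact ⟨u, mem_connectors.2 ⟨hu, h⟩⟩

lemma mem_connectors_iff_eq_sup {A : Finset V} {g : Sym2 V → Prop} {u : V} (hu : u ∈ A) :
    u ∈ connectors A g ↔ internalDegree A g u = A.sup (internalDegree A g) := by
  rw [mem_connectors, and_iff_right hu, ← Finset.sup_le_iff]
  exact ⟨fun h => le_antisymm (Finset.le_sup hu) h, fun h => h.ge⟩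

lemma internalDegree_mono [Finite V] {A : Finset V} {g g' : Sym2 V → Prop} (h : ∀ s, g s → g' s)
    (u : V) : internalDegree A g u ≤ internalDegree A g' u :=
  Set.ncard_le_ncard (fun _ hv => ⟨hv.1, hv.2.1, h _ hv.2.2⟩) (Set.toFinite _)

lemma internalDegree_congr {A : Finset V} {g g' : Sym2 V → Prop} {u : V}
    (h : ∀ v ∈ A, v ≠ u → (g s(u, v) ↔ g' s(u, v))) :
    internalDegree A g u = internalDegree A g' u := by
  unfold internalDegree
  congr 1
  ext v
  simp only [Set.mem_ofPred_eq]
  exact and_congr_right fun hv => and_congr_right fun hne => h v hv hne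

lemma connectors_congr {A : Finset V} {g g' : Sym2 V → Prop}
    (h : ∀ u ∈ A, ∀ v ∈ A, v ≠ u → (g s(u, v) ↔ g' s(u, v))) :
    connectors A g = connectors A g' := by
  have hd : ∀ u ∈ A, internalDegree A g u = internalDegree A g' u :=
    fun u hu => internalDegree_congr (h u hu)
  ext u
  rw [mem_connectors, mem_connectors]
  refine and_congr_right fun hu => forall₂_congr fun v hv => ?_
  rw [hd u hu, hd v hv]

/-- Adding edges inside `O` keeps a connector inside `O`. -/
lemma exists_mem_connectors_of_le [Finite V] {A O : Finset V} (hOA : O ⊆ A)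
    {g g' : Sym2 V → Prop}
    (hle : ∀ s, g s → g' s) (heq : ∀ u v, u ∉ O → (g s(u, v) ↔ g' s(u, v)))
    (h : ∃ o ∈ O, o ∈ connectors A g) : ∃ o ∈ O, o ∈ connectors A g' := by
  obtain ⟨o, ho, hmax⟩ := h
  obtain ⟨o', ho', hmax'⟩ := O.exists_max_image (internalDegree A g') ⟨o, ho⟩
  refine ⟨o', ho', mem_connectors.2 ⟨hOA ho', fun v hv => ?_⟩⟩
  by_cases hvO : v ∈ O
  · exact hmax' v hvO
  · calc internalDegree A g' v = internalDegree A g v :=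
          (internalDegree_congr fun w _ _ => heq v w hvO).symm
      _ ≤ internalDegree A g o := (mem_connectors.1 hmax).2 v hv
      _ ≤ internalDegree A g' o := internalDegree_mono hle o
      _ ≤ internalDegree A g' o' := hmax' o ho

lemma internalDegree_comp_map {A : Finset V} (σ : Equiv.Perm V) (hσ : ∀ v, σ v ∈ A ↔ v ∈ A)
    (g : Sym2 V → Prop) (u : V) :
    internalDegree A (fun s => g (s.map σ)) u = internalDegree A g (σ u) := by
  unfold internalDegree
  rw [← Set.ncard_image_of_injective _ σ.injective]
  congr 1
  ext w
  obtain ⟨v, rfl⟩ := σ.surjective w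
  simp [hσ]

lemma mem_connectors_comp_map {A : Finset V} (σ : Equiv.Perm V) (hσ : ∀ v, σ v ∈ A ↔ v ∈ A)
    (g : Sym2 V → Prop) (u : V) :
    u ∈ connectors A (fun s => g (s.map σ)) ↔ σ u ∈ connectors A g := by
  simp only [mem_connectors, internalDegree_comp_map σ hσ, hσ]
  refine and_congr_right fun _ => ⟨fun h v hv => ?_, fun h v hv => h _ ((hσ v).2 hv)⟩
  obtain ⟨w, rfl⟩ := σ.surjective v
  exact h w ((hσ w).1 hv)

lemma connectorWeight_comp_map {A : Finset V} (σ : Equiv.Perm V) (hσ : ∀ v, σ v ∈ A ↔ v ∈ A)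
    (g : Sym2 V → Prop) (u : V) :
    connectorWeight A (fun s => g (s.map σ)) u = connectorWeight A g (σ u) := by
  have hcard : (connectors A fun s => g (s.map σ)).card = (connectors A g).card := by
    rw [← Finset.card_map σ.toEmbedding]
    congr 1
    ext w
    obtain ⟨v, rfl⟩ := σ.surjective w
    simp [mem_connectors_comp_map σ hσ]
  classical
  unfold connectorWeight
  rw [hcard]
  exact if_congr (mem_connectors_comp_map σ hσ g u) rfl rfl

lemma connectorWeight_nonneg (A : Finset V) (g : Sym2 V → Prop) (u : V) :
    0 ≤ connectorWeight A g u := by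
  unfold connectorWeight
  split_ifs <;> positivity

lemma sum_connectorWeight {A : Finset V} (hA : A.Nonempty) (g : Sym2 V → Prop) :
    ∑ u ∈ A, connectorWeight A g u = 1 := by
  classical
  have hne : ((connectors A g).card : ℝ) ≠ 0 := by
    exact_mod_cast (connectors_nonempty hA g).card_pos.ne'
  simp only [connectorWeight]
  rw [← Finset.sum_filter, Finset.filter_mem_eq_inter,
    Finset.inter_eq_right.2 (connectors_subset A g), Finset.sum_const, nsmul_eq_mul,
    mul_inv_cancel₀ hne]

lemma connectorWeight_le_one {A : Finset V} (hA : A.Nonempty) (g : Sym2 V → Prop) {u : V}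
    (hu : u ∈ A) : connectorWeight A g u ≤ 1 :=
  (Finset.single_le_sum (fun v _ => connectorWeight_nonneg A g v) hu).trans_eq
    (sum_connectorWeight hA g)

lemma connectorWeight_empty {A : Finset V} {g : Sym2 V → Prop} (hg : ∀ s, ¬ g s) {u : V}
    (hu : u ∈ A) : connectorWeight A g u = (A.card : ℝ)⁻¹ := by
  have h : connectors A g = A := by
    ext v
    simp [mem_connectors, internalDegree, hg]
  rw [connectorWeight, h, if_pos hu]

open Classical in
/-- The weight of `O` is at most the indicator of `O` containing a connector, with an explicit gap
at the empty graph. -/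
lemma sum_connectorWeight_add_le {A O : Finset V} (hOA : O ⊆ A) (hO : O.Nonempty)
    (g : Sym2 V → Prop) :
    ∑ u ∈ O, connectorWeight A g u +
        (1 - (O.card : ℝ) / A.card) * (if ∀ s, ¬ g s then 1 else 0) ≤
      if ∃ o ∈ O, o ∈ connectors A g then 1 else 0 := by
  have hA := hO.mono hOA
  by_cases hg : ∀ s, ¬ g s
  · have hsum : ∑ u ∈ O, connectorWeight A g u = (O.card : ℝ) / A.card := by
      rw [Finset.sum_congr rfl fun u hu => connectorWeight_empty hg (hOA hu)]
      simp [div_eq_mul_inv]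
    obtain ⟨o, ho⟩ := hO
    have hex : ∃ o ∈ O, o ∈ connectors A g :=
      ⟨o, ho, mem_connectors.2 ⟨hOA ho, by simp [internalDegree, hg]⟩⟩
    rw [if_pos hg, if_pos hex, hsum]
    linarith
  · rw [if_neg hg, mul_zero, add_zero]
    split_ifs with hex
    · rw [← sum_connectorWeight hA g]
      exact Finset.sum_le_sum_of_subset_of_nonneg hOA
        fun v _ _ => connectorWeight_nonneg A g v
    · push Not at hex
      exact (Finset.sum_eq_zero fun u hu => by simp [connectorWeight, hex u hu]).le

end Degree

section UniformThreshold

variable {V : Type*} [Fintype V]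

lemma measurable_comp_coord_le {κ : Type*} [Fintype κ] {β : Type*} [MeasurableSpace β]
    (q : κ → unitInterval) (f : (κ → Prop) → β) :
    Measurable fun U : κ → unitInterval => f fun s => U s ≤ q s :=
  (Measurable.of_discrete (f := f)).comp <| measurable_pi_iff.2 fun s =>
    measurableSet_setOfPred.1 (measurableSet_le (measurable_pi_apply s) measurable_const)

lemma integrable_connectorWeight {A : Finset V} (q : Sym2 V → unitInterval) {u : V}
    (hu : u ∈ A) :
    Integrable fun U : Sym2 V → unitInterval => connectorWeight A (fun s => U s ≤ q s) u := by
  refine Integrable.of_bound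
    (measurable_comp_coord_le q fun g => connectorWeight A g u).aestronglyMeasurable 1
    (Filter.Eventually.of_forall fun U => ?_)
  rw [Real.norm_of_nonneg (connectorWeight_nonneg _ _ _)]
  exact connectorWeight_le_one ⟨u, hu⟩ _ hu

lemma integral_connectorWeight_eq {A : Finset V} (p : unitInterval) {a b : V}
    (ha : a ∈ A) (hb : b ∈ A) :
    ∫ U : Sym2 V → unitInterval, connectorWeight A (fun s => U s ≤ p) a =
      ∫ U : Sym2 V → unitInterval, connectorWeight A (fun s => U s ≤ p) b := by
  classical
  set σ : Equiv.Perm V := Equiv.swap a b with hσdef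
  have hσ : ∀ v, σ v ∈ A ↔ v ∈ A := fun v => by
    rw [hσdef, Equiv.swap_apply_def]
    split_ifs with h₁ h₂ <;> simp_all
  let e : Sym2 V ≃ Sym2 V := Equiv.ofBijective (Sym2.map σ)
    (Finite.injective_iff_bijective.1 (Sym2.map.injective σ.injective))
  have hT := volume_measurePreserving_piCongrLeft (fun _ : Sym2 V => unitInterval) e
  rw [← hT.integral_comp' (g := fun U => connectorWeight A (fun s => U s ≤ p) b)]
  congr 1
  ext U
  have hb' : b = σ a := by simp [hσdef]
  rw [hb', ← connectorWeight_comp_map σ hσ]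
  congr 1
  ext s
  have hs : s.map σ = e s := rfl
  rw [hs, MeasurableEquiv.piCongrLeft_apply_apply]

lemma integral_connectorWeight {A : Finset V} (p : unitInterval) {a : V} (ha : a ∈ A) :
    ∫ U : Sym2 V → unitInterval, connectorWeight A (fun s => U s ≤ p) a = (A.card : ℝ)⁻¹ := by
  have hsum : ∑ b ∈ A, ∫ U : Sym2 V → unitInterval, connectorWeight A (fun s => U s ≤ p) b = 1 := by
    rw [← integral_finsetSum _ fun b hb => integrable_connectorWeight (fun _ => p) hb]
    simp [sum_connectorWeight ⟨a, ha⟩]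
  rw [Finset.sum_congr rfl fun b hb => integral_connectorWeight_eq p hb ha, Finset.sum_const,
    nsmul_eq_mul] at hsum
  exact eq_inv_of_mul_eq_one_right hsum

/-- With equal edge probabilities smaller than one, a proper nonempty subset `O` of `A` contains a
connector with probability larger than `|O| / |A|`. -/
lemma card_div_card_lt_volume_exists_connector {A O : Finset V} (hOA : O ⊆ A)
    (hO : O.Nonempty) (hlt : O.card < A.card) {p : unitInterval} (hp : p < 1) :
    (O.card : ℝ) / A.card <
      volume.real {U : Sym2 V → unitInterval |
        ∃ o ∈ O, o ∈ connectors A fun s => U s ≤ p} := by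
  classical
  have hempty : MeasurableSet {U : Sym2 V → unitInterval | ∀ s, ¬ U s ≤ p} :=
    measurableSet_setOfPred.2 (measurable_comp_coord_le (fun _ => p) fun g => ∀ s, ¬ g s)
  have hgood : MeasurableSet {U : Sym2 V → unitInterval |
      ∃ o ∈ O, o ∈ connectors A fun s => U s ≤ p} :=
    measurableSet_setOfPred.2
      (measurable_comp_coord_le (fun _ => p) fun g => ∃ o ∈ O, o ∈ connectors A g)
  have hpos : 0 < volume.real {U : Sym2 V → unitInterval | ∀ s, ¬ U s ≤ p} := by
    have hset : {U : Sym2 V → unitInterval | ∀ s, ¬ U s ≤ p} =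
        Set.univ.pi fun _ => Set.Ioi p := by
      ext U
      simp
    rw [measureReal_def, hset, volume_pi_pi]
    simp only [unitInterval.volume_Ioi, ENNReal.toReal_prod]
    refine Finset.prod_pos fun _ _ => ?_
    have hp' : (p : ℝ) < 1 := by exact_mod_cast hp
    exact ENNReal.toReal_pos (by simpa using hp') ENNReal.ofReal_ne_top
  have hgap : 0 < 1 - (O.card : ℝ) / A.card := by
    have hA0 : (0 : ℝ) < A.card := by exact_mod_cast hlt.pos
    rw [sub_pos, div_lt_one hA0]
    exact_mod_cast hlt
  have hw : Integrable fun U : Sym2 V → unitInterval =>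
      ∑ u ∈ O, connectorWeight A (fun s => U s ≤ p) u :=
    integrable_finsetSum _ fun u hu => integrable_connectorWeight (fun _ => p) (hOA hu)
  have he : Integrable fun U : Sym2 V → unitInterval => (1 - (O.card : ℝ) / A.card) *
      {U : Sym2 V → unitInterval | ∀ s, ¬ U s ≤ p}.indicator 1 U :=
    ((integrable_const 1).indicator hempty).const_mul _
  have hmono := integral_mono (hw.add he) (g := {U : Sym2 V → unitInterval |
      ∃ o ∈ O, o ∈ connectors A fun s => U s ≤ p}.indicator 1)
    ((integrable_const 1).indicator hgood) fun U => by
      simp only [Pi.add_apply, Set.indicator_apply, Set.mem_ofPred_eq, Pi.one_apply]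
      have := sum_connectorWeight_add_le hOA hO fun s => U s ≤ p
      refine le_trans (le_of_eq ?_) (this.trans (le_of_eq ?_)) <;> congr
  rw [integral_add' hw he,
    integral_finsetSum _ fun u hu => integrable_connectorWeight (fun _ => p) (hOA hu),
    Finset.sum_congr rfl fun u hu => integral_connectorWeight p (hOA hu),
    integral_const_mul, integral_indicator_one hempty, integral_indicator_one hgood,
    Finset.sum_const, nsmul_eq_mul, ← div_eq_mul_inv] at hmono
  have := mul_pos hgap hpos
  linarith

end UniformThreshold

open MeasureTheory ProbabilityTheory

/-- Observation 3 (AGM): with communities `A ⊇ O` (the overlap), independent events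
`E s` over unordered pairs `s` of distinct elements of `A`, occurring with probability
`1 - (1-p_A)(1-p_B)` for pairs inside `O` and `p_A` otherwise, the probability that some
node of the overlap `O` attains the maximal internal degree of `A` is strictly greater
than `|O| / |A|`. -/
theorem connector_in_overlap {V : Type*} [Fintype V] [DecidableEq V]
    {Ω : Type*} [MeasureSpace Ω] [IsProbabilityMeasure (ℙ : Measure Ω)]
    (A O : Finset V) (hOA : O ⊆ A) (hA : 3 ≤ A.card)
    (hO : 2 ≤ O.card) (hOlt : O.card < A.card)
    (pA pB : ℝ) (hpA0 : 0 < pA) (hpA1 : pA < 1) (hpB0 : 0 < pB) (hpB1 : pB ≤ 1)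
    (E : Sym2 V → Set Ω)
    (hmeas : ∀ s : Sym2 V, MeasurableSet (E s))
    (hindep : iIndepSet
      (fun s : {s : Sym2 V // ¬ s.IsDiag ∧ ∀ v ∈ s, v ∈ A} => E s.1) ℙ)
    (hprobO : ∀ u v : V, u ≠ v → u ∈ O → v ∈ O →
      ((ℙ : Measure Ω) (E s(u, v))).toReal = 1 - (1 - pA) * (1 - pB))
    (hprobA : ∀ u v : V, u ≠ v → u ∈ A → v ∈ A → ¬(u ∈ O ∧ v ∈ O) →
      ((ℙ : Measure Ω) (E s(u, v))).toReal = pA)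
    (d : V → Ω → ℕ)
    (hd : ∀ u ω, d u ω = Set.ncard {v : V | v ∈ A ∧ v ≠ u ∧ ω ∈ E s(u, v)}) :
    ((ℙ : Measure Ω)
        {ω | ∃ o ∈ O, d o ω = A.sup (fun u => d u ω)}).toReal
      > (O.card : ℝ) / (A.card : ℝ) := by
  classical
  have hOne : O.Nonempty := Finset.card_pos.1 (by omega)
  let p : unitInterval := ⟨pA, hpA0.le, hpA1.le⟩
  let r : unitInterval := ⟨1 - (1 - pA) * (1 - pB), by constructor <;> nlinarith⟩
  have hpr : p ≤ r := by
    change pA ≤ 1 - (1 - pA) * (1 - pB)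
    nlinarith
  let q : Sym2 V → unitInterval := fun s => if ∀ v ∈ s, v ∈ O then r else p
  have hpq : ∀ s, p ≤ q s := fun s => by
    simp only [q]
    split_ifs
    exacts [hpr, le_rfl]
  let J := {s : Sym2 V // ¬ s.IsDiag ∧ ∀ v ∈ s, v ∈ A}
  let lift : (J → Prop) → Sym2 V → Prop := fun g s => ∃ h, g ⟨s, h⟩
  have hlift : ∀ g : Sym2 V → Prop,
      connectors A (lift fun s => g s.1) = connectors A g := fun g => by
    refine connectors_congr fun u hu v hv hne => ?_
    simp [lift, hu, hv, hne.symm]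
  have hprob : ∀ s : J, (ℙ : Measure Ω) (E s.1) =
      volume {U : Sym2 V → unitInterval | U s.1 ≤ q s.1} := by
    rintro ⟨s, hs, hsA⟩
    rw [volume_coord_le, ← ENNReal.ofReal_toReal (measure_ne_top ℙ (E s))]
    congr 1
    induction s using Sym2.ind with
    | _ u v =>
      simp only [Sym2.mk_isDiag_iff] at hs
      simp only [Sym2.mem_iff, forall_eq_or_imp, forall_eq] at hsA
      by_cases h : u ∈ O ∧ v ∈ O
      · simp [hprobO u v hs h.1 h.2, q, h, r]
      · simp [hprobA u v hs hsA.1 hsA.2 h, q, h, p]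
  have hlaw := iIndepSet_measure_setOf_eq (fun s : J => hmeas s.1)
    (fun s : J => measurableSet_le (measurable_pi_apply s.1) measurable_const) hindep
    ((iIndepSet_coord_le q).precomp Subtype.val_injective) hprob
    (fun g => ∃ o ∈ O, o ∈ connectors A (lift g))
  have hevent : {ω | ∃ o ∈ O, d o ω = A.sup fun u => d u ω} =
      {ω | ∃ o ∈ O, o ∈ connectors A (lift fun s : J => ω ∈ E s.1)} := by
    ext ω
    refine exists_congr fun o => and_congr_right fun ho => ?_
    rw [hlift fun s => ω ∈ E s, mem_connectors_iff_eq_sup (hOA ho)]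
    simp only [hd]
    rfl
  rw [hevent, hlaw]
  refine (card_div_card_lt_volume_exists_connector hOA hOne hOlt (p := p) hpA1).trans_le
    (measureReal_mono fun U hU => ?_)
  change ∃ o ∈ O, o ∈ connectors A (lift fun s : J => U s.1 ≤ q s.1)
  rw [hlift fun s => U s ≤ q s]
  refine exists_mem_connectors_of_le hOA (fun s hs => hs.trans (hpq s)) (fun u v hu => ?_) hU
  simp [q, hu]
end

section
/- Let C be a finite type, and let P_E and P_N be finite index sets (edge pairs and non-edge pairs). For each e ∈ P_E let S_e be a nonempty finite subset of C, and for each e ∈ P_N let T_e be a finite subset of C. Then the function F : (C → ℝ) → ℝ defined by F(x) = ∑_{e∈P_E} log(1 − e^(−∑_{k∈S_e} x_k)) − ∑_{e∈P_N} ∑_{k∈T_e} x_k is concave on the convex set {x : C → ℝ | x_k > 0 for all k ∈ C}. -/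
/-- A finite sum of concave functions is concave. -/
theorem concaveOn_finset_sum {ι E : Type*} [AddCommGroup E] [Module ℝ E] {s : Set E}
    (hs : Convex ℝ s) (t : Finset ι) {f : ι → E → ℝ} (hf : ∀ i ∈ t, ConcaveOn ℝ s (f i)) :
    ConcaveOn ℝ s (fun x => ∑ i ∈ t, f i x) := by
  refine ⟨hs, fun x hx y hy a b ha hb hab => ?_⟩
  simp only [Finset.smul_sum, ← Finset.sum_add_distrib]
  exact Finset.sum_le_sum fun i hi => (hf i hi).2 hx hy ha hb hab

/-- The function `t ↦ log (1 - exp (-t))` is concave on the positive half-line. -/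
theorem concaveOn_log_one_sub_exp_neg :
    ConcaveOn ℝ (Set.Ioi 0) (fun t : ℝ => Real.log (1 - Real.exp (-t))) := by
  refine ⟨convex_Ioi 0, fun x hx y hy a b ha hb hab => ?_⟩
  have pos {t : ℝ} (ht : t ∈ Set.Ioi 0) : 0 < 1 - Real.exp (-t) :=
    sub_pos.2 (Real.exp_lt_one_iff.2 (neg_lt_zero.2 ht))
  have hlog := strictConcaveOn_log_Ioi.concaveOn.2 (pos hx) (pos hy) ha hb hab
  have hexp := convexOn_exp.2 (Set.mem_univ (-x)) (Set.mem_univ (-y)) ha hb hab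
  have hmem := convex_Ioi (0 : ℝ) (pos hx) (pos hy) ha hb hab
  refine hlog.trans (Real.log_le_log hmem ?_)
  simp only [smul_eq_mul, mul_neg, ← neg_add] at hexp ⊢
  linarith

/-- The transformed AGM log-likelihood
`F x = ∑_{e ∈ P_E} log (1 - exp (-∑_{k ∈ S e} x k)) - ∑_{e ∈ P_N} ∑_{k ∈ T e} x k`
is concave on the convex set of strictly positive vectors. -/
theorem agm_loglikelihood_concave {C : Type*} [Fintype C]
    {PE PN : Type*} [Fintype PE] [Fintype PN]
    (S : PE → Finset C) (hS : ∀ e, (S e).Nonempty) (T : PN → Finset C) :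
    ConcaveOn ℝ {x : C → ℝ | ∀ k, 0 < x k}
      (fun x : C → ℝ =>
        (∑ e : PE, Real.log (1 - Real.exp (-(∑ k ∈ S e, x k)))) -
        ∑ e : PN, ∑ k ∈ T e, x k) := by
  have hconv : Convex ℝ {x : C → ℝ | ∀ k, 0 < x k} := by
    have h := convex_pi (𝕜 := ℝ) (s := Set.univ) fun (k : C) _ => convex_Ioi (𝕜 := ℝ) (0 : ℝ)
    simpa [Set.pi] using h
  let coordSum (A : Finset C) : (C → ℝ) →ₗ[ℝ] ℝ := ∑ k ∈ A, LinearMap.proj k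
  have hcoordSum (A : Finset C) (x : C → ℝ) : coordSum A x = ∑ k ∈ A, x k := by
    simp [coordSum]
  refine (concaveOn_finset_sum hconv Finset.univ fun e _ => ?_).sub ?_
  · have h := concaveOn_log_one_sub_exp_neg.comp_linearMap (coordSum (S e))
    simp only [Function.comp_def, hcoordSum] at h
    refine h.subset (fun x hx => ?_) hconv
    simpa [hcoordSum] using Finset.sum_pos (fun k _ => hx k) (hS e)
  · have h := (∑ e : PN, coordSum (T e)).convexOn hconv
    exact h.congr fun x _ => by simp [hcoordSum]
end
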